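/- Let m ≥ 2 be an integer and n odd with 1 ≤ n ≤ 4m−1, and let θ ∈ ℕ₀ satisfy either (1 ≤ n ≤ 2m−1 and 2m−n+1 ≤ θ ≤ 4m−n) or (2m+1 ≤ n ≤ 4m−1 and θ = 0). For each choice of sign ±, there exist a constant b₀ ∈ ℝ∖{0} depending only on n and m, constants a_j^± ∈ ℂ∖ℝ for 0 ≤ j ≤ ⌊(θ−1)/2⌋, and a smooth function r_θ^± : (0,∞) → ℂ such that: (a) for all λ > 0 and all x ≠ y in ℝⁿ, R₀^±(λ^{2m})(x,y) = Σ_{0 ≤ j ≤ ⌊(θ−1)/2⌋} a_j^± λ^{n−2m+2j} |x−y|^{2j} + b₀ |x−y|^{2m−n} + λ^{n−2m} r_θ^±(λ|x−y|); (b) for every l ∈ ℕ₀ there is C_l > 0 with |d^l r_θ^±/dz^l (z)| ≤ C_l z^{max{θ−l, 0}} for 0 < z ≤ 1 and |d^l r_θ^±/dz^l (z)| ≤ C_l z^{max{θ−l, −(n−1)/2}} for z ≥ 1. -/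

import Mathlib

open MeasureTheory Finset

/-- The coefficients `c_j` in the explicit formula for the free resolvent kernel. -/
noncomputable def cCoef (n : ℕ) (j : ℤ) : ℝ :=
  if j = -1 then -(1/2 : ℝ)
  else ((-2 : ℝ)) ^ j.toNat * (Nat.factorial (n - 3 - j.toNat)) /
      ((Nat.factorial j.toNat) * (Nat.factorial ((((n : ℤ) - 3) / 2 - j).toNat)))

/-- `λ_k = λ e^{ikπ/m}`. -/
noncomputable def lamK (m : ℕ) (lam : ℝ) (k : ℕ) : ℂ :=
  (lam : ℂ) * Complex.exp (Complex.I * (k : ℂ) * (Real.pi : ℂ) / (m : ℂ))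

/-- The limiting free resolvent kernel `R₀^±(λ^{2m})(x,y)` of `(-Δ)^m` on `ℝⁿ`, odd `n`,
as a function of `λ` and `r = |x - y|`.  The sign `+` corresponds to `sgn = true`
(with `I⁺ = {0, …, m-1}`), the sign `-` to `sgn = false` (with `I⁻ = {1, …, m}`). -/
noncomputable def R0Kernel (m n : ℕ) (sgn : Bool) (lam r : ℝ) : ℂ :=
  ((((4 * Real.pi) ^ (-(((n : ℝ) - 1) / 2)) : ℝ)) : ℂ) *
    ((m : ℂ) * (lam : ℂ) ^ (2 * m))⁻¹ *
    ∑ k ∈ (if sgn then Finset.range m else Finset.Icc 1 m),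
      (lamK m lam k) ^ 2 * Complex.exp (Complex.I * lamK m lam k * (r : ℂ)) *
        (r : ℂ) ^ (-((n : ℤ) - 2)) *
        ∑ j ∈ Finset.Icc (min 0 (((n : ℤ) - 3) / 2)) (((n : ℤ) - 3) / 2),
          ((cCoef n j : ℝ) : ℂ) * (Complex.I * lamK m lam k * (r : ℂ)) ^ j

/-- Coefficients `d_j` such that `w * ∑ c_j w ^ j = ∑ d_j w ^ j` in dimension `2 * N + 1`. -/
noncomputable def polyCoef : ℕ → ℕ → ℝ
  | 0, 0 => -(1 / 2)
  | 0, _ + 1 => 0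
  | _ + 1, 0 => 0
  | N + 1, j + 1 =>
    if j ≤ N then (-2) ^ j * (2 * N - j).factorial / (j.factorial * (N - j).factorial) else 0

theorem polyCoef_rec (N s : ℕ) :
    ((s : ℝ) + 1) * polyCoef (N + 1) (s + 2) + polyCoef (N + 1) (s + 1) =
      -2 * polyCoef N s := by
  rcases N with _ | M
  · rcases s with _ | s <;> simp [polyCoef]
  rcases s with _ | t
  · have h1 : 2 * (M + 1) - (0 + 1) = 2 * M + 1 := by omega
    have h2 : 2 * (M + 1) - 0 = 2 * M + 1 + 1 := by omega
    simp only [polyCoef, h1, h2, Nat.factorial_succ, Nat.sub_zero, Nat.add_sub_cancel]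
    have := Nat.factorial_ne_zero M
    simp
    field_simp
    ring
  rcases le_or_gt t M with h | h
  · obtain ⟨u, rfl⟩ := Nat.exists_eq_add_of_le h
    have e1 : 2 * (t + u + 1) - (t + 1) = t + 2 * u + 1 := by omega
    have e2 : 2 * (t + u) - t = t + 2 * u := by omega
    have e3 : t + u + 1 - (t + 1) = u := by omega
    have e4 : t + u - t = u := by omega
    rcases u with _ | u
    · have e5 : ¬ (t + 1 + 1 ≤ t + 0 + 1) := by omega
      simp only [polyCoef, e1, e3, if_neg e5, Nat.factorial_succ]
      simp only [Nat.sub_self, show 2 * t - t = t by omega]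
      simp
      field_simp
      ring
    · have e5 : t + 1 + 1 ≤ t + (u + 1) + 1 := by omega
      have e6 : t + 1 ≤ t + (u + 1) + 1 := by omega
      have e7 : t ≤ t + (u + 1) := by omega
      have e8 : t + (u + 1) + 1 - (t + 1 + 1) = u := by omega
      have e9 : 2 * (t + (u + 1) + 1) - (t + 1 + 1) = t + 2 * (u + 1) := by omega
      simp only [polyCoef, e1, e2, e3, e4, e8, e9, if_pos e5, if_pos e6, if_pos e7,
        Nat.factorial_succ]
      push_cast
      field_simp
      ring
  · have e1 : ¬ (t + 1 + 1 ≤ M + 1) := by omega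
    have e2 : ¬ (t + 1 ≤ M + 1) := by omega
    simp [polyCoef, h.not_ge]
    omega

/-- The Taylor series of `w ↦ exp w * ∑ d_j w ^ j`. -/
noncomputable def profileSeries (N : ℕ) : PowerSeries ℝ :=
  PowerSeries.mk (polyCoef N) * PowerSeries.exp ℝ

theorem coeff_profileSeries_rec (N s : ℕ) :
    ((s : ℝ) + 1) * PowerSeries.coeff (s + 2) (profileSeries (N + 1)) =
      -2 * PowerSeries.coeff s (profileSeries N) := by
  have hq : (PowerSeries.X : PowerSeries ℝ) *
      (PowerSeries.derivative ℝ (PowerSeries.mk (polyCoef (N + 1))) +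
        PowerSeries.mk (polyCoef (N + 1))) - PowerSeries.mk (polyCoef (N + 1)) =
      PowerSeries.C (-2 : ℝ) * (PowerSeries.X ^ 2 * PowerSeries.mk (polyCoef N)) := by
    ext s
    rcases s with _ | _ | s
    · simp [polyCoef]
    · have : (PowerSeries.X ^ 2 : PowerSeries ℝ) = PowerSeries.X * PowerSeries.X := sq _
      simp only [this, mul_assoc, map_sub, PowerSeries.coeff_C_mul]
      rw [PowerSeries.coeff_succ_X_mul, PowerSeries.coeff_succ_X_mul, map_add,
        PowerSeries.coeff_derivative, PowerSeries.coeff_zero_X_mul]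
      simp [polyCoef]
    · change PowerSeries.coeff (s + 2) _ = PowerSeries.coeff (s + 2) _
      rw [map_sub, PowerSeries.coeff_C_mul, PowerSeries.coeff_X_pow_mul,
        PowerSeries.coeff_succ_X_mul]
      simp only [map_add, PowerSeries.coeff_derivative, PowerSeries.coeff_mk]
      rw [← polyCoef_rec]
      push_cast
      ring
  have hA : (PowerSeries.X : PowerSeries ℝ) *
      PowerSeries.derivative ℝ (profileSeries (N + 1)) - profileSeries (N + 1) =
      PowerSeries.C (-2 : ℝ) * (PowerSeries.X ^ 2 * profileSeries N) := by
    have he : PowerSeries.derivative ℝ (PowerSeries.exp ℝ) = PowerSeries.exp ℝ := by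
      ext s
      simp only [PowerSeries.coeff_derivative, PowerSeries.coeff_exp, Nat.factorial_succ]
      simp
      field_simp
    unfold profileSeries
    rw [Derivation.leibniz, he, smul_eq_mul, smul_eq_mul]
    linear_combination PowerSeries.exp ℝ * hq
  have h := congrArg (PowerSeries.coeff (s + 2)) hA
  rw [map_sub, PowerSeries.coeff_C_mul, PowerSeries.coeff_X_pow_mul,
    PowerSeries.coeff_succ_X_mul, PowerSeries.coeff_derivative] at h
  push_cast at h
  linear_combination h

theorem coeff_profileSeries_ne_zero (N s : ℕ) (h : Odd s ∨ 2 * N ≤ s) :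
    PowerSeries.coeff s (profileSeries N) ≠ 0 := by
  induction N generalizing s with
  | zero =>
    have : PowerSeries.mk (polyCoef 0) = PowerSeries.C (-(1 / 2) : ℝ) := by
      ext j
      rcases j with _ | j <;> simp [polyCoef]
    rw [profileSeries, this, PowerSeries.coeff_C_mul, PowerSeries.coeff_exp]
    simp [Nat.factorial_ne_zero]
  | succ N ih =>
    rcases s with _ | _ | s
    · simp at h
    · have := Nat.factorial_ne_zero N
      have := Nat.factorial_ne_zero (2 * N)
      simp [profileSeries, PowerSeries.coeff_mul, Finset.Nat.antidiagonal_succ,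
        polyCoef, *]
    · have h' := coeff_profileSeries_rec N s
      have h2 := ih s (by
        rcases h with h | h
        · left
          obtain ⟨k, hk⟩ := h
          exact ⟨k - 1, by omega⟩
        · right; omega)
      intro h0
      rw [h0] at h'
      apply h2
      linarith

theorem coeff_profileSeries_eq_zero (N s : ℕ) (h : Even s) (hs : s < 2 * N) :
    PowerSeries.coeff s (profileSeries N) = 0 := by
  induction N generalizing s with
  | zero => omega
  | succ N ih =>
    rcases s with _ | _ | s
    · simp [profileSeries, polyCoef]
    · simp at h
    · have h' := coeff_profileSeries_rec N s
      rw [ih s (by simpa [Nat.even_add] using h) (by omega), mul_zero] at h'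
      exact (mul_eq_zero.mp h').resolve_left (by positivity)

/-- The entire function `f` has Taylor series `p` at `0`, with an entire remainder factor at every
order. -/
def HasEntireTaylor (f : ℂ → ℂ) (p : PowerSeries ℝ) : Prop :=
  ∀ M : ℕ, ∃ G : ℂ → ℂ, Differentiable ℂ G ∧
    ∀ w, f w = ∑ s ∈ Finset.range M, ((PowerSeries.coeff s p : ℝ) : ℂ) * w ^ s + w ^ M * G w

theorem hasEntireTaylor_exp : HasEntireTaylor Complex.exp (PowerSeries.exp ℝ) := by
  intro M
  induction M with
  | zero => exact ⟨Complex.exp, Complex.differentiable_exp, by simp⟩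
  | succ M ih =>
    obtain ⟨G, hG, h⟩ := ih
    have hG0 : G 0 = ((PowerSeries.coeff M (PowerSeries.exp ℝ) : ℝ) : ℂ) := by
      set c : ℂ := ((PowerSeries.coeff M (PowerSeries.exp ℝ) : ℝ) : ℂ) with hc
      have hb : ∀ w : ℂ, w ≠ 0 → ‖G w - c‖ ≤ ‖w‖ * Real.exp ‖w‖ := by
        intro w hw
        have hb := Complex.norm_exp_sub_sum_le_norm_mul_exp w (M + 1)
        have e : Complex.exp w - ∑ s ∈ Finset.range (M + 1), w ^ s / (s.factorial : ℂ) =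
            w ^ M * (G w - c) := by
          have hcc : c = 1 / (M.factorial : ℂ) := by simp [hc, PowerSeries.coeff_exp]
          rw [h w, Finset.sum_range_succ, hcc]
          have : ∑ s ∈ Finset.range M,
              ((PowerSeries.coeff s (PowerSeries.exp ℝ) : ℝ) : ℂ) * w ^ s =
              ∑ s ∈ Finset.range M, w ^ s / (s.factorial : ℂ) := by
            refine Finset.sum_congr rfl fun s _ => ?_
            simp [PowerSeries.coeff_exp]
            ring
          rw [this]
          ring
        rw [e, norm_mul, norm_pow, pow_succ, mul_assoc] at hb
        exact le_of_mul_le_mul_left hb (by positivity)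
      have h1 : Filter.Tendsto (fun w => G w - c) (nhdsWithin 0 {0}ᶜ) (nhds 0) := by
        refine squeeze_zero_norm' (a := fun w : ℂ => ‖w‖ * Real.exp ‖w‖) ?_ ?_
        · filter_upwards [self_mem_nhdsWithin] with w hw using hb w hw
        · have : Continuous fun w : ℂ => ‖w‖ * Real.exp ‖w‖ := by fun_prop
          simpa using (this.tendsto 0).mono_left nhdsWithin_le_nhds
      have h2 : Filter.Tendsto (fun w => G w - c) (nhdsWithin 0 {0}ᶜ) (nhds (G 0 - c)) :=
        ((hG.continuous.sub continuous_const).tendsto 0).mono_left nhdsWithin_le_nhds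
      exact sub_eq_zero.mp (tendsto_nhds_unique h2 h1)
    refine ⟨dslope G 0, ?_, fun w => ?_⟩
    · rw [← differentiableOn_univ] at hG ⊢
      exact (Complex.differentiableOn_dslope Filter.univ_mem).mpr hG
    · have := sub_smul_dslope G 0 w
      rw [sub_zero, smul_eq_mul] at this
      rw [h w, Finset.sum_range_succ, ← hG0, pow_succ]
      linear_combination - w ^ M * this

theorem HasEntireTaylor.add {f g : ℂ → ℂ} {p q : PowerSeries ℝ} (hf : HasEntireTaylor f p)
    (hg : HasEntireTaylor g q) : HasEntireTaylor (fun w => f w + g w) (p + q) := by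
  intro M
  obtain ⟨F, hF, h1⟩ := hf M
  obtain ⟨G, hG, h2⟩ := hg M
  refine ⟨fun w => F w + G w, hF.add hG, fun w => ?_⟩
  simp only [h1 w, h2 w, map_add, Complex.ofReal_add, add_mul, Finset.sum_add_distrib]
  ring

theorem HasEntireTaylor.const_mul {f : ℂ → ℂ} {p : PowerSeries ℝ} (hf : HasEntireTaylor f p)
    (c : ℝ) : HasEntireTaylor (fun w => c * f w) (PowerSeries.C c * p) := by
  intro M
  obtain ⟨F, hF, h1⟩ := hf M
  refine ⟨fun w => c * F w, hF.const_mul _, fun w => ?_⟩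
  simp only [h1 w, PowerSeries.coeff_C_mul, Complex.ofReal_mul, mul_assoc, ← Finset.mul_sum]
  ring

theorem HasEntireTaylor.X_mul {f : ℂ → ℂ} {p : PowerSeries ℝ} (hf : HasEntireTaylor f p) :
    HasEntireTaylor (fun w => w * f w) (PowerSeries.X * p) := by
  rintro (_ | M)
  · obtain ⟨G, hG, h⟩ := hf 0
    exact ⟨fun w => w * G w, differentiable_id.mul hG, fun w => by simp [h w]⟩
  · obtain ⟨G, hG, h⟩ := hf M
    refine ⟨G, hG, fun w => ?_⟩
    simp only [h w, Finset.sum_range_succ', PowerSeries.coeff_succ_X_mul,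
      PowerSeries.coeff_zero_X_mul, pow_succ, mul_add, Finset.mul_sum]
    simp only [Complex.ofReal_zero, zero_mul, add_zero]
    congr 1
    · exact Finset.sum_congr rfl fun s _ => by ring
    · ring

theorem HasEntireTaylor.X_pow_mul {f : ℂ → ℂ} {p : PowerSeries ℝ} (hf : HasEntireTaylor f p)
    (j : ℕ) : HasEntireTaylor (fun w => w ^ j * f w) (PowerSeries.X ^ j * p) := by
  induction j with
  | zero => simpa using hf
  | succ j ih => simpa only [pow_succ', mul_assoc] using ih.X_mul

/-- The entire function whose Taylor series is `profileSeries N`. -/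
noncomputable def profile (N : ℕ) (w : ℂ) : ℂ :=
  Complex.exp w * ∑ j ∈ Finset.range (N + 1), (polyCoef N j : ℂ) * w ^ j

theorem hasEntireTaylor_profile (N : ℕ) : HasEntireTaylor (profile N) (profileSeries N) := by
  have key : ∀ K : ℕ, HasEntireTaylor
      (fun w => ∑ j ∈ Finset.range K, (polyCoef N j : ℂ) * (w ^ j * Complex.exp w))
      (∑ j ∈ Finset.range K,
        PowerSeries.C (polyCoef N j) * (PowerSeries.X ^ j * PowerSeries.exp ℝ)) := by
    intro K
    induction K with
    | zero => exact fun M => ⟨0, differentiable_const 0, by simp⟩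
    | succ K ih =>
      simp only [Finset.sum_range_succ]
      exact ih.add ((hasEntireTaylor_exp.X_pow_mul K).const_mul _)
  have hpoly : PowerSeries.mk (polyCoef N) =
      ∑ j ∈ Finset.range (N + 1), PowerSeries.C (polyCoef N j) * PowerSeries.X ^ j := by
    ext s
    simp only [PowerSeries.coeff_mk, map_sum, PowerSeries.coeff_C_mul, PowerSeries.coeff_X_pow,
      mul_ite, mul_one, mul_zero, Finset.sum_ite_eq, Finset.mem_range]
    split_ifs with h
    · rfl
    · rcases N with _ | N <;> rcases s with _ | s <;> simp_all [polyCoef]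
  convert key (N + 1) using 1
  · ext w
    rw [profile, Finset.mul_sum]
    exact Finset.sum_congr rfl fun j _ => by ring
  · rw [profileSeries, hpoly, Finset.sum_mul]
    exact Finset.sum_congr rfl fun j _ => by ring

/-- `f` is smooth on `(0, ∞)` and its `l`-th derivative is `O(z ^ w l)` on `[1, ∞)`. -/
def DerivGrowth (w : ℕ → ℤ) (f : ℝ → ℂ) : Prop :=
  (∀ k : ℕ, ContDiffOn ℝ k f (Set.Ioi 0)) ∧
    ∀ l : ℕ, ∃ C : ℝ, ∀ z : ℝ, 1 ≤ z → ‖iteratedDerivWithin l f (Set.Ioi 0) z‖ ≤ C * z ^ w l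

theorem DerivGrowth.add {w : ℕ → ℤ} {f g : ℝ → ℂ} (hf : DerivGrowth w f) (hg : DerivGrowth w g) :
    DerivGrowth w (fun z => f z + g z) := by
  refine ⟨fun k => (hf.1 k).add (hg.1 k), fun l => ?_⟩
  obtain ⟨A, hA⟩ := hf.2 l
  obtain ⟨B, hB⟩ := hg.2 l
  refine ⟨A + B, fun z hz => ?_⟩
  have hz0 : z ∈ Set.Ioi (0 : ℝ) := lt_of_lt_of_le one_pos hz
  rw [iteratedDerivWithin_fun_add hz0 (uniqueDiffOn_Ioi 0) (hf.1 l z hz0) (hg.1 l z hz0), add_mul]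
  exact (norm_add_le _ _).trans (add_le_add (hA z hz) (hB z hz))

theorem DerivGrowth.const_mul {w : ℕ → ℤ} {f : ℝ → ℂ} (hf : DerivGrowth w f) (c : ℂ) :
    DerivGrowth w (fun z => c * f z) := by
  refine ⟨fun k => contDiffOn_const.mul (hf.1 k), fun l => ?_⟩
  obtain ⟨A, hA⟩ := hf.2 l
  refine ⟨‖c‖ * A, fun z hz => ?_⟩
  rw [iteratedDerivWithin_const_mul_field, norm_mul, mul_assoc]
  exact mul_le_mul_of_nonneg_left (hA z hz) (norm_nonneg c)

theorem DerivGrowth.sum {ι : Type*} {w : ℕ → ℤ} (s : Finset ι) {f : ι → ℝ → ℂ}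
    (hf : ∀ i ∈ s, DerivGrowth w (f i)) : DerivGrowth w (fun z => ∑ i ∈ s, f i z) := by
  classical
  induction s using Finset.induction_on with
  | empty =>
    refine ⟨fun k => by simpa using contDiffOn_const, fun l => ⟨0, fun z _ => ?_⟩⟩
    simp
  | insert i s hi ih =>
    simp only [Finset.sum_insert hi]
    exact (hf i (Finset.mem_insert_self i s)).add
      (ih fun j hj => hf j (Finset.mem_insert_of_mem hj))

theorem hasDerivAt_exp_mul_zpow (α : ℂ) (p : ℤ) {z : ℝ} (hz : 0 < z) :
    HasDerivAt (fun z : ℝ => Complex.exp (α * z) * (z : ℂ) ^ p)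
      (α * (Complex.exp (α * z) * (z : ℂ) ^ p) +
        p * (Complex.exp (α * z) * (z : ℂ) ^ (p - 1))) z := by
  have hz' : (z : ℂ) ≠ 0 := by exact_mod_cast hz.ne'
  have h1 : HasDerivAt (fun u : ℂ => Complex.exp (α * u)) (Complex.exp (α * z) * α) (z : ℂ) := by
    simpa using ((hasDerivAt_id (z : ℂ)).const_mul α).cexp
  convert (h1.fun_mul (hasDerivAt_zpow p (z : ℂ) (Or.inl hz'))).comp_ofReal using 1
  ring

theorem derivWithin_exp_mul_zpow (α : ℂ) (p : ℤ) :
    Set.EqOn (derivWithin (fun z : ℝ => Complex.exp (α * z) * (z : ℂ) ^ p) (Set.Ioi 0))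
      (fun z : ℝ => α * (Complex.exp (α * z) * (z : ℂ) ^ p) +
        p * (Complex.exp (α * z) * (z : ℂ) ^ (p - 1))) (Set.Ioi 0) := fun z hz =>
  (hasDerivAt_exp_mul_zpow α p hz).hasDerivWithinAt.derivWithin (uniqueDiffOn_Ioi 0 z hz)

theorem contDiffOn_exp_mul_zpow (α : ℂ) (p : ℤ) (k : ℕ) :
    ContDiffOn ℝ k (fun z : ℝ => Complex.exp (α * z) * (z : ℂ) ^ p) (Set.Ioi 0) := by
  induction k generalizing p with
  | zero =>
    exact contDiffOn_zero.mpr fun z hz =>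
      (hasDerivAt_exp_mul_zpow α p hz).continuousAt.continuousWithinAt
  | succ k ih =>
    rw [Nat.cast_succ, contDiffOn_succ_iff_derivWithin (uniqueDiffOn_Ioi 0)]
    refine ⟨fun z hz => (hasDerivAt_exp_mul_zpow α p hz).differentiableAt.differentiableWithinAt,
      by simp, ?_⟩
    exact ((contDiffOn_const.mul (ih p)).add (contDiffOn_const.mul (ih (p - 1)))).congr
      (derivWithin_exp_mul_zpow α p)

theorem iteratedDerivWithin_succ_exp_mul_zpow (α : ℂ) (p : ℤ) (l : ℕ) {z : ℝ} (hz : 0 < z) :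
    iteratedDerivWithin (l + 1) (fun z : ℝ => Complex.exp (α * z) * (z : ℂ) ^ p) (Set.Ioi 0) z =
      α * iteratedDerivWithin l (fun z : ℝ => Complex.exp (α * z) * (z : ℂ) ^ p) (Set.Ioi 0) z +
        p * iteratedDerivWithin l
          (fun z : ℝ => Complex.exp (α * z) * (z : ℂ) ^ (p - 1)) (Set.Ioi 0) z := by
  replace hz : z ∈ Set.Ioi (0 : ℝ) := hz
  rw [iteratedDerivWithin_succ', iteratedDerivWithin_congr (derivWithin_exp_mul_zpow α p) hz,
    iteratedDerivWithin_fun_add hz (uniqueDiffOn_Ioi 0)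
      (contDiffOn_const.mul (contDiffOn_exp_mul_zpow α p l) z hz)
      (contDiffOn_const.mul (contDiffOn_exp_mul_zpow α (p - 1) l) z hz),
    iteratedDerivWithin_const_mul_field, iteratedDerivWithin_const_mul_field]

theorem derivGrowth_exp_mul_zpow {α : ℂ} (hα : α.re ≤ 0) {p : ℤ} {w : ℕ → ℤ}
    (hw : ∀ l, p ≤ w l) :
    DerivGrowth w (fun z : ℝ => Complex.exp (α * z) * (z : ℂ) ^ p) := by
  refine ⟨contDiffOn_exp_mul_zpow α p, fun l => ?_⟩
  have key : ∀ (l : ℕ) (q : ℤ), q ≤ p → ∃ C : ℝ, ∀ z : ℝ, 1 ≤ z →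
      ‖iteratedDerivWithin l (fun z : ℝ => Complex.exp (α * z) * (z : ℂ) ^ q) (Set.Ioi 0) z‖ ≤
        C * z ^ p := by
    intro l
    induction l with
    | zero =>
      refine fun q hq => ⟨1, fun z hz => ?_⟩
      have hz0 : 0 < z := one_pos.trans_le hz
      rw [iteratedDerivWithin_zero, norm_mul, norm_zpow, Complex.norm_real, Complex.norm_exp,
        Real.norm_of_nonneg hz0.le]
      have h1 : Real.exp (α * (z : ℂ)).re ≤ 1 := by
        rw [Real.exp_le_one_iff]
        simpa using mul_nonpos_of_nonpos_of_nonneg hα hz0.le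
      exact mul_le_mul h1 (zpow_le_zpow_right₀ hz hq) (by positivity) zero_le_one
    | succ l ih =>
      intro q hq
      obtain ⟨A, hA⟩ := ih q hq
      obtain ⟨B, hB⟩ := ih (q - 1) (by omega)
      refine ⟨‖α‖ * A + ‖(q : ℂ)‖ * B, fun z hz => ?_⟩
      rw [iteratedDerivWithin_succ_exp_mul_zpow α q l (one_pos.trans_le hz), add_mul, mul_assoc,
        mul_assoc]
      refine (norm_add_le _ _).trans (add_le_add ?_ ?_) <;> rw [norm_mul]
      · exact mul_le_mul_of_nonneg_left (hA z hz) (norm_nonneg _)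
      · exact mul_le_mul_of_nonneg_left (hB z hz) (norm_nonneg _)
  obtain ⟨C, hC⟩ := key l p le_rfl
  refine ⟨|C|, fun z hz => (hC z hz).trans ?_⟩
  have hz0 : 0 < z := one_pos.trans_le hz
  exact mul_le_mul (le_abs_self C) (zpow_le_zpow_right₀ hz (hw l)) (by positivity) (abs_nonneg C)

theorem derivGrowth_zpow {p : ℤ} {w : ℕ → ℤ} (hw : ∀ l : ℕ, p - l ≤ w l) :
    DerivGrowth w (fun z : ℝ => (z : ℂ) ^ p) := by
  have e : ∀ q : ℤ, (fun z : ℝ => Complex.exp (0 * z) * (z : ℂ) ^ q) = fun z : ℝ => (z : ℂ) ^ q :=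
    fun q => by simp
  refine ⟨fun k => by simpa using contDiffOn_exp_mul_zpow 0 p k, fun l => ?_⟩
  have key : ∀ (l : ℕ) (q : ℤ), ∃ C : ℝ, ∀ z : ℝ, 1 ≤ z →
      ‖iteratedDerivWithin l (fun z : ℝ => (z : ℂ) ^ q) (Set.Ioi 0) z‖ ≤ C * z ^ (q - l) := by
    intro l
    induction l with
    | zero =>
      refine fun q => ⟨1, fun z hz => ?_⟩
      simp [abs_of_pos (one_pos.trans_le hz)]
    | succ l ih =>
      intro q
      obtain ⟨B, hB⟩ := ih (q - 1)
      refine ⟨‖(q : ℂ)‖ * B, fun z hz => ?_⟩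
      have h := iteratedDerivWithin_succ_exp_mul_zpow 0 q l (one_pos.trans_le hz)
      rw [e, e, zero_mul, zero_add] at h
      have e2 : q - (l + 1 : ℕ) = q - 1 - l := by push_cast; ring
      rw [h, norm_mul, mul_assoc, e2]
      exact mul_le_mul_of_nonneg_left (hB z hz) (norm_nonneg _)
  obtain ⟨C, hC⟩ := key l p
  refine ⟨|C|, fun z hz => (hC z hz).trans ?_⟩
  have hz0 : 0 < z := one_pos.trans_le hz
  exact mul_le_mul (le_abs_self C) (zpow_le_zpow_right₀ hz (hw l)) (by positivity) (abs_nonneg C)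

theorem exists_iteratedDerivWithin_le_of_eq_pow_mul {f G : ℝ → ℂ}
    (hG : ContDiff ℝ (⊤ : ℕ∞) G) (θ l : ℕ) (h : ∀ z : ℝ, 0 < z → f z = (z : ℂ) ^ θ * G z) :
    ∃ C : ℝ, ∀ z : ℝ, 0 < z → z ≤ 1 →
      ‖iteratedDerivWithin l f (Set.Ioi 0) z‖ ≤ C * z ^ (θ - l) := by
  induction l generalizing f G θ with
  | zero =>
    obtain ⟨C, hC⟩ := isCompact_Icc.exists_bound_of_continuousOn
      (s := Set.Icc (0 : ℝ) 1) hG.continuous.continuousOn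
    refine ⟨C, fun z hz hz1 => ?_⟩
    rw [iteratedDerivWithin_zero, h z hz, norm_mul, norm_pow, Complex.norm_real,
      Real.norm_of_nonneg hz.le, Nat.sub_zero, mul_comm C]
    exact mul_le_mul_of_nonneg_left (hC z ⟨hz.le, hz1⟩) (by positivity)
  | succ l ih =>
    have hd : ∀ z : ℝ, HasDerivAt (fun z : ℝ => (z : ℂ) ^ θ * G z)
        ((θ : ℂ) * (z : ℂ) ^ (θ - 1) * G z + (z : ℂ) ^ θ * deriv G z) z := fun z =>
      ((hasDerivAt_pow θ (z : ℂ)).comp_ofReal).mul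
        (hG.differentiable (by simp)).differentiableAt.hasDerivAt
    have hG' : ContDiff ℝ (⊤ : ℕ∞) (deriv G) := (contDiff_infty_iff_deriv.mp hG).2
    have hderiv : ∀ z : ℝ, 0 < z → derivWithin f (Set.Ioi 0) z =
        (θ : ℂ) * (z : ℂ) ^ (θ - 1) * G z + (z : ℂ) ^ θ * deriv G z := fun z hz => by
      refine (derivWithin_congr (fun u hu => h u hu) (h z hz)).trans ?_
      exact (hd z).hasDerivWithinAt.derivWithin (uniqueDiffOn_Ioi 0 z hz)
    have hcast : ContDiff ℝ (⊤ : ℕ∞) (fun z : ℝ => (z : ℂ)) := Complex.ofRealCLM.contDiff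
    simp only [iteratedDerivWithin_succ']
    rcases θ with _ | θ
    · obtain ⟨C, hC⟩ := ih hG' 0 (f := derivWithin f (Set.Ioi 0))
        fun z hz => by rw [hderiv z hz]; simp
      exact ⟨C, fun z hz hz1 => by simpa using hC z hz hz1⟩
    · obtain ⟨C, hC⟩ := ih (f := derivWithin f (Set.Ioi 0))
        (G := fun z => ((θ + 1 : ℕ) : ℂ) * G z + z * deriv G z)
        ((contDiff_const.mul hG).add (hcast.mul hG')) θ
        fun z hz => by rw [hderiv z hz, Nat.add_sub_cancel, pow_succ]; ring
      exact ⟨C, fun z hz hz1 => by simpa using hC z hz hz1⟩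

/-- The primitive `2m`-th root of unity `e^{iπ/m}`. -/
noncomputable def unitRoot (m : ℕ) : ℂ := Complex.exp (Complex.I * Real.pi / m)

/-- The index sets `I⁺ = {0, …, m-1}` and `I⁻ = {1, …, m}`. -/
def signIndex (m : ℕ) (sgn : Bool) : Finset ℕ := if sgn then Finset.range m else Finset.Icc 1 m

theorem lamK_eq (m : ℕ) (lam : ℝ) (k : ℕ) : lamK m lam k = lam * unitRoot m ^ k := by
  rw [lamK, unitRoot, ← Complex.exp_nat_mul]
  congr 2
  ring

theorem isPrimitiveRoot_unitRoot {m : ℕ} (hm : m ≠ 0) : IsPrimitiveRoot (unitRoot m) (2 * m) := by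
  convert Complex.isPrimitiveRoot_exp (2 * m) (by omega) using 1
  rw [unitRoot]
  congr 1
  have : (m : ℂ) ≠ 0 := by exact_mod_cast hm
  push_cast
  field_simp

theorem unitRoot_pow_self {m : ℕ} (hm : m ≠ 0) : unitRoot m ^ m = -1 := by
  have : (m : ℂ) ≠ 0 := by exact_mod_cast hm
  rw [unitRoot, ← Complex.exp_nat_mul, mul_div_cancel₀ _ this, mul_comm, Complex.exp_pi_mul_I]

theorem unitRoot_pow_im_nonneg {m k : ℕ} (hk : k ≤ m) : 0 ≤ (unitRoot m ^ k).im := by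
  have e : unitRoot m ^ k = Complex.exp (((k * Real.pi / m : ℝ) : ℂ) * Complex.I) := by
    rw [unitRoot, ← Complex.exp_nat_mul]
    congr 1
    push_cast
    ring
  rw [e, Complex.exp_ofReal_mul_I_im]
  apply Real.sin_nonneg_of_nonneg_of_le_pi (by positivity)
  rw [mul_div_right_comm]
  refine mul_le_of_le_one_left Real.pi_pos.le (div_le_one_of_le₀ ?_ (Nat.cast_nonneg m))
  exact_mod_cast hk

theorem le_of_mem_signIndex {m k : ℕ} {sgn : Bool} (hk : k ∈ signIndex m sgn) : k ≤ m := by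
  cases sgn
  · exact (Finset.mem_Icc.mp hk).2
  · exact (Finset.mem_range.mp hk).le

theorem sum_signIndex_pow (m : ℕ) (sgn : Bool) (x : ℂ) :
    ∑ k ∈ signIndex m sgn, x ^ k = (if sgn then 1 else x) * ∑ k ∈ Finset.range m, x ^ k := by
  cases sgn
  · simp only [signIndex, Bool.false_eq_true, if_false, Finset.mul_sum, ← pow_succ']
    rw [Finset.range_eq_Ico, Finset.sum_Ico_add' (fun k => x ^ k) 0 m 1]
    rfl
  · simp [signIndex]

/-- The sums `∑ ω ^ (k t)` over the index sets, `ω = e^{iπ/m}`. -/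
noncomputable def rootSum (m : ℕ) (sgn : Bool) (t : ℕ) : ℂ :=
  ∑ k ∈ signIndex m sgn, (unitRoot m ^ t) ^ k

theorem geom_sum_unitRoot {m : ℕ} (hm : m ≠ 0) (t : ℕ) :
    (∑ k ∈ Finset.range m, (unitRoot m ^ t) ^ k) * (unitRoot m ^ t - 1) = (-1) ^ t - 1 := by
  rw [geom_sum_mul, ← pow_mul, mul_comm, pow_mul, unitRoot_pow_self hm]

theorem rootSum_eq_zero {m : ℕ} (hm : m ≠ 0) (sgn : Bool) {t : ℕ} (ht : Even t)
    (hd : ¬ 2 * m ∣ t) : rootSum m sgn t = 0 := by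
  have h := geom_sum_unitRoot hm t
  rw [ht.neg_one_pow, sub_self] at h
  have h1 : unitRoot m ^ t - 1 ≠ 0 := fun h0 =>
    hd ((isPrimitiveRoot_unitRoot hm).pow_eq_one_iff_dvd t |>.mp (sub_eq_zero.mp h0))
  rw [rootSum, sum_signIndex_pow, (mul_eq_zero.mp h).resolve_right h1, mul_zero]

theorem rootSum_two_mul {m : ℕ} (hm : m ≠ 0) (sgn : Bool) : rootSum m sgn (2 * m) = m := by
  have h : unitRoot m ^ (2 * m) = 1 := (isPrimitiveRoot_unitRoot hm).pow_eq_one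
  cases sgn <;> simp [rootSum, h, signIndex]

theorem rootSum_re_ne_zero {m : ℕ} (hm : m ≠ 0) (sgn : Bool) {t : ℕ} (ht : Odd t) :
    (rootSum m sgn t).re ≠ 0 := by
  have h := geom_sum_unitRoot hm t
  rw [ht.neg_one_pow] at h
  have hnorm : Complex.normSq (unitRoot m ^ t) = 1 := by
    rw [Complex.normSq_eq_norm_sq, norm_pow,
      (isPrimitiveRoot_unitRoot hm).norm'_eq_one (by omega), one_pow, one_pow]
  rw [rootSum, sum_signIndex_pow]
  generalize ∑ k ∈ Finset.range m, (unitRoot m ^ t) ^ k = S at *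
  generalize unitRoot m ^ t = x at *
  have hre : S.re = 1 := by
    have h1 := congrArg Complex.re h
    have h2 := congrArg Complex.im h
    rw [Complex.normSq_apply] at hnorm
    simp at h1 h2
    have hx : x.re ≠ 1 := by
      intro hx
      have : x.im = 0 := by
        rw [hx] at hnorm
        simpa using hnorm
      rw [hx, this] at h1
      norm_num at h1
    have : (S.re - 1) * (2 * (1 - x.re)) = 0 := by
      linear_combination (1 - x.re) * (-h1) + x.im * h2 - S.re * hnorm
    rcases mul_eq_zero.mp this with h3 | h3
    · linarith
    · exact absurd (by linarith) hx
  cases sgn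
  · have : x * S = S - 2 := by linear_combination h
    simp [this, hre]
    norm_num
  · simp [hre]

theorem inner_sum_eq (N : ℕ) {w : ℂ} (hw : w ≠ 0) :
    w * ∑ j ∈ Finset.Icc (min 0 ((((2 * N + 1 : ℕ) : ℤ) - 3) / 2)) ((((2 * N + 1 : ℕ) : ℤ) - 3) / 2),
      ((cCoef (2 * N + 1) j : ℝ) : ℂ) * w ^ j =
    ∑ j ∈ Finset.range (N + 1), (polyCoef N j : ℂ) * w ^ j := by
  rcases N with _ | N
  · have : Finset.Icc (min 0 ((((2 * 0 + 1 : ℕ) : ℤ) - 3) / 2)) ((((2 * 0 + 1 : ℕ) : ℤ) - 3) / 2) =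
        {-1} := by decide
    rw [this]
    simp [cCoef, polyCoef]
    field_simp
  · have h1 : (((2 * (N + 1) + 1 : ℕ) : ℤ) - 3) / 2 = N := by omega
    have h2 : Finset.Icc (0 : ℤ) N =
        (Finset.range (N + 1)).map ⟨fun j : ℕ => (j : ℤ), Nat.cast_injective⟩ := by
      ext j
      simp only [Finset.mem_Icc, Finset.mem_map, Finset.mem_range, Function.Embedding.coeFn_mk]
      constructor
      · exact fun h => ⟨j.toNat, by omega, by omega⟩
      · rintro ⟨i, hi, rfl⟩
        omega
    rw [h1, min_eq_left (by positivity), h2, Finset.sum_map, Finset.sum_range_succ' _ (N + 1),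
      Finset.mul_sum]
    simp only [polyCoef, Complex.ofReal_zero, zero_mul, add_zero]
    refine Finset.sum_congr rfl fun j hj => ?_
    have hj' : j ≤ N := Nat.lt_succ_iff.mp (Finset.mem_range.mp hj)
    have h3 : (j : ℤ) ≠ -1 := by omega
    have h4 : 2 * (N + 1) + 1 - 3 - j = 2 * N - j := by omega
    have h5 : ((N : ℤ) - j).toNat = N - j := by omega
    simp only [Function.Embedding.coeFn_mk, cCoef, if_neg h3, if_pos hj', h1, Int.toNat_natCast,
      h4, h5, zpow_natCast, pow_succ]
    ring

/-- The normalizing factor `(4π)^{-N} / m`. -/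
noncomputable def kernelFactor (m N : ℕ) : ℝ := (4 * Real.pi) ^ (-(N : ℝ)) / m

theorem kernelFactor_pos {m : ℕ} (hm : m ≠ 0) (N : ℕ) : 0 < kernelFactor m N := by
  have : (0 : ℝ) < m := by exact_mod_cast Nat.pos_of_ne_zero hm
  unfold kernelFactor
  positivity

/-- The free resolvent kernel at `λ = 1` in dimension `2 * N + 1`. -/
noncomputable def unitKernel (m N : ℕ) (sgn : Bool) (z : ℝ) : ℂ :=
  kernelFactor m N * -Complex.I * (z : ℂ) ^ (-(2 * N : ℤ)) *
    ∑ k ∈ signIndex m sgn, unitRoot m ^ k * profile N (Complex.I * unitRoot m ^ k * z)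

theorem R0Kernel_eq (m N : ℕ) (sgn : Bool) {lam r : ℝ} (hl : 0 < lam) (hr : 0 < r) :
    R0Kernel m (2 * N + 1) sgn lam r =
      (lam : ℂ) ^ (((2 * N + 1 : ℕ) : ℤ) - 2 * m) * unitKernel m N sgn (lam * r) := by
  have hl' : (lam : ℂ) ≠ 0 := by exact_mod_cast hl.ne'
  have hr' : (r : ℂ) ≠ 0 := by exact_mod_cast hr.ne'
  have hu : ∀ k, unitRoot m ^ k ≠ 0 := fun k => pow_ne_zero _ (Complex.exp_ne_zero _)
  have hN : -((((2 * N + 1 : ℕ) : ℝ) - 1) / 2) = -(N : ℝ) := by push_cast; ring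
  have h1 : (lam : ℂ) ^ (((2 * N + 1 : ℕ) : ℤ) - 2 * m) =
      lam ^ (2 * N + 1) / lam ^ (2 * m) := by
    rw [zpow_sub₀ hl', zpow_natCast]
    norm_cast
  have h2 : (r : ℂ) ^ (-(((2 * N + 1 : ℕ) : ℤ) - 2)) = r / r ^ (2 * N) := by
    rw [show -(((2 * N + 1 : ℕ) : ℤ) - 2) = 1 - (2 * N : ℕ) by push_cast; ring, zpow_sub₀ hr',
      zpow_one, zpow_natCast]
  have h3 : ((lam * r : ℝ) : ℂ) ^ (-(2 * N : ℤ)) = 1 / (lam ^ (2 * N) * r ^ (2 * N)) := by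
    rw [zpow_neg, Complex.ofReal_mul, mul_zpow, one_div]
    norm_cast
  rw [R0Kernel, unitKernel, hN, h1, h3, kernelFactor, Finset.mul_sum, Finset.mul_sum,
    Finset.mul_sum]
  refine Finset.sum_congr rfl fun k _ => ?_
  have hw : Complex.I * lamK m lam k * (r : ℂ) ≠ 0 := by
    rw [lamK_eq]
    exact mul_ne_zero (mul_ne_zero Complex.I_ne_zero (mul_ne_zero hl' (hu k))) hr'
  have hs := inner_sum_eq N hw
  have hw2 : Complex.I * unitRoot m ^ k * ((lam * r : ℝ) : ℂ) = Complex.I * lamK m lam k * r := by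
    rw [lamK_eq]
    push_cast
    ring
  rw [profile, hw2, ← hs, h2, lamK_eq]
  generalize (Finset.sum (Finset.Icc (min 0 ((((2 * N + 1 : ℕ) : ℤ) - 3) / 2)) _) _ : ℂ) = S
  generalize Complex.exp _ = E
  push_cast
  generalize (((4 * Real.pi) ^ (-(N : ℝ)) : ℝ) : ℂ) = A
  have := hu k
  generalize unitRoot m ^ k = x at *
  field_simp
  rw [Complex.I_sq]
  ring

/-- The coefficient of `z ^ (s - 2 * N)` in the expansion of `unitKernel m N sgn` at `0`. -/
noncomputable def kernelCoef (m N : ℕ) (sgn : Bool) (s : ℕ) : ℂ :=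
  kernelFactor m N * -Complex.I * PowerSeries.coeff s (profileSeries N) * Complex.I ^ s *
    rootSum m sgn (s + 1)

theorem unitKernel_expansion (m N : ℕ) (sgn : Bool) (θ : ℕ) :
    ∃ G : ℝ → ℂ, ContDiff ℝ (⊤ : ℕ∞) G ∧ ∀ z : ℝ, 0 < z → unitKernel m N sgn z =
      ∑ s ∈ Finset.range (2 * N + θ), kernelCoef m N sgn s * (z : ℂ) ^ ((s : ℤ) - 2 * N) +
        (z : ℂ) ^ θ * G z := by
  obtain ⟨G, hG, h⟩ := hasEntireTaylor_profile N (2 * N + θ)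
  have hG' : ContDiff ℝ (⊤ : ℕ∞) G := (hG.contDiff (n := (⊤ : ℕ∞))).restrict_scalars ℝ
  have hcast : ContDiff ℝ (⊤ : ℕ∞) (fun z : ℝ => (z : ℂ)) := Complex.ofRealCLM.contDiff
  refine ⟨fun z => kernelFactor m N * -Complex.I * ∑ k ∈ signIndex m sgn,
    unitRoot m ^ k * (Complex.I * unitRoot m ^ k) ^ (2 * N + θ) *
      G (Complex.I * unitRoot m ^ k * z), ?_, fun z hz => ?_⟩
  · exact contDiff_const.mul (ContDiff.sum fun k _ =>
      contDiff_const.mul (hG'.comp (contDiff_const.mul hcast)))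
  · have hz' : (z : ℂ) ≠ 0 := by exact_mod_cast hz.ne'
    have hz2 : (z : ℂ) ^ (-(2 * N : ℤ)) * (z : ℂ) ^ (2 * N + θ) = (z : ℂ) ^ θ := by
      rw [← zpow_natCast, ← zpow_natCast, ← zpow_add₀ hz']
      congr 1
      push_cast
      ring
    have hz3 : ∀ s : ℕ, (z : ℂ) ^ ((s : ℤ) - 2 * N) = (z : ℂ) ^ (-(2 * N : ℤ)) * (z : ℂ) ^ s :=
      fun s => by rw [← zpow_natCast, ← zpow_add₀ hz']; congr 1; ring
    simp only [unitKernel, h, mul_add, Finset.sum_add_distrib]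
    congr 1
    · simp only [Finset.mul_sum]
      rw [Finset.sum_comm]
      refine Finset.sum_congr rfl fun s _ => ?_
      rw [kernelCoef, rootSum, hz3, Finset.mul_sum, Finset.sum_mul]
      refine Finset.sum_congr rfl fun k _ => ?_
      rw [← pow_mul (unitRoot m) (s + 1) k, mul_comm (s + 1) k, pow_mul, pow_succ]
      ring
    · rw [← hz2]
      simp only [Finset.mul_sum]
      refine Finset.sum_congr rfl fun k _ => ?_
      ring

theorem derivGrowth_unitKernel (m N : ℕ) (sgn : Bool) {w : ℕ → ℤ} (hw : ∀ l, -(N : ℤ) ≤ w l) :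
    DerivGrowth w (fun z => ∑ k ∈ signIndex m sgn, ∑ j ∈ Finset.range (N + 1),
      kernelFactor m N * -Complex.I * unitRoot m ^ k * polyCoef N j *
        (Complex.I * unitRoot m ^ k) ^ j *
        (Complex.exp (Complex.I * unitRoot m ^ k * z) * (z : ℂ) ^ ((j : ℤ) - 2 * N))) := by
  refine DerivGrowth.sum _ fun k hk => DerivGrowth.sum _ fun j hj => DerivGrowth.const_mul ?_ _
  refine derivGrowth_exp_mul_zpow ?_ fun l => ?_
  · simpa using unitRoot_pow_im_nonneg (le_of_mem_signIndex hk)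
  · have := Finset.mem_range.mp hj
    have := hw l
    omega

theorem unitKernel_eq_sum (m N : ℕ) (sgn : Bool) {z : ℝ} (hz : 0 < z) :
    unitKernel m N sgn z = ∑ k ∈ signIndex m sgn, ∑ j ∈ Finset.range (N + 1),
      kernelFactor m N * -Complex.I * unitRoot m ^ k * polyCoef N j *
        (Complex.I * unitRoot m ^ k) ^ j *
        (Complex.exp (Complex.I * unitRoot m ^ k * z) * (z : ℂ) ^ ((j : ℤ) - 2 * N)) := by
  have hz' : (z : ℂ) ≠ 0 := by exact_mod_cast hz.ne'
  simp only [unitKernel, profile, Finset.mul_sum]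
  refine Finset.sum_congr rfl fun k _ => Finset.sum_congr rfl fun j _ => ?_
  rw [sub_eq_neg_add, zpow_add₀ hz', zpow_natCast]
  ring

theorem kernelCoef_eq_zero_of_even {m N s : ℕ} (sgn : Bool) (h : Even s) (hs : s < 2 * N) :
    kernelCoef m N sgn s = 0 := by
  simp [kernelCoef, coeff_profileSeries_eq_zero N s h hs]

theorem kernelCoef_eq_zero_of_odd {m N s : ℕ} (hm : m ≠ 0) (sgn : Bool) (h : Odd s)
    (hd : ¬ 2 * m ∣ s + 1) : kernelCoef m N sgn s = 0 := by
  simp [kernelCoef, rootSum_eq_zero hm sgn h.add_one hd]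

theorem kernelCoef_im_ne_zero {m N : ℕ} (hm : m ≠ 0) (sgn : Bool) (j : ℕ) :
    (kernelCoef m N sgn (2 * N + 2 * j)).im ≠ 0 := by
  have e : kernelCoef m N sgn (2 * N + 2 * j) =
      ((kernelFactor m N * PowerSeries.coeff (2 * N + 2 * j) (profileSeries N) *
        (-1) ^ (N + j) : ℝ) : ℂ) * (-Complex.I * rootSum m sgn (2 * N + 2 * j + 1)) := by
    rw [kernelCoef, ← mul_add, pow_mul, Complex.I_sq]
    push_cast
    ring
  rw [e, Complex.im_ofReal_mul]
  refine mul_ne_zero (mul_ne_zero (mul_ne_zero (kernelFactor_pos hm N).ne' ?_) ?_) ?_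
  · exact coeff_profileSeries_ne_zero N _ (Or.inr (by omega))
  · exact pow_ne_zero _ (by norm_num)
  · simpa using rootSum_re_ne_zero hm sgn (t := 2 * N + 2 * j + 1) ⟨N + j, by ring⟩

theorem kernelCoef_two_mul_sub_one {m : ℕ} (N : ℕ) (hm : m ≠ 0) (sgn : Bool) :
    kernelCoef m N sgn (2 * m - 1) = ((kernelFactor m N * m * -(-1) ^ m *
      PowerSeries.coeff (2 * m - 1) (profileSeries N) : ℝ) : ℂ) := by
  have h1 : 2 * m - 1 + 1 = 2 * m := by omega
  have h2 : Complex.I * Complex.I ^ (2 * m - 1) = (-1) ^ m := by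
    rw [← pow_succ', h1, pow_mul, Complex.I_sq]
  rw [kernelCoef, h1, rootSum_two_mul hm]
  push_cast
  rw [← h2]
  ring

theorem sum_range_eq_sum_even_add_sum_odd {A : Type*} [AddCommMonoid A] (g : ℕ → A) (M : ℕ) :
    ∑ s ∈ Finset.range M, g s = ∑ i ∈ Finset.range ((M + 1) / 2), g (2 * i) +
      ∑ i ∈ Finset.range (M / 2), g (2 * i + 1) := by
  induction M with
  | zero => simp
  | succ M ih =>
    rw [Finset.sum_range_succ, ih]
    rcases Nat.even_or_odd' M with ⟨k, rfl | rfl⟩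
    · rw [show (2 * k + 1 + 1) / 2 = k + 1 by omega, show (2 * k + 1) / 2 = k by omega,
        show 2 * k / 2 = k by omega, Finset.sum_range_succ]
      abel
    · rw [show (2 * k + 1 + 1 + 1) / 2 = k + 1 by omega, show (2 * k + 1 + 1) / 2 = k + 1 by omega,
        show (2 * k + 1) / 2 = k by omega, Finset.sum_range_succ (fun i => g (2 * i + 1)) k]
      abel

theorem sum_kernelCoef {m N θ : ℕ} (hm : m ≠ 0) (sgn : Bool) (h1 : 2 * m ≤ 2 * N + θ)
    (h2 : 2 * N + θ < 4 * m) (z : ℝ) :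
    ∑ s ∈ Finset.range (2 * N + θ), kernelCoef m N sgn s * (z : ℂ) ^ ((s : ℤ) - 2 * N) =
      ∑ j ∈ Finset.range ((θ + 1) / 2), kernelCoef m N sgn (2 * N + 2 * j) * (z : ℂ) ^ (2 * j) +
        kernelCoef m N sgn (2 * m - 1) * (z : ℂ) ^ (2 * (m : ℤ) - (2 * N + 1 : ℕ)) := by
  rw [sum_range_eq_sum_even_add_sum_odd, show (2 * N + θ + 1) / 2 = N + (θ + 1) / 2 by omega,
    Finset.sum_range_add]
  have e1 : ∑ i ∈ Finset.range N,
      kernelCoef m N sgn (2 * i) * (z : ℂ) ^ (((2 * i : ℕ) : ℤ) - 2 * N) = 0 :=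
    Finset.sum_eq_zero fun i hi => by
      rw [kernelCoef_eq_zero_of_even sgn (even_two_mul i)
        (by have := Finset.mem_range.mp hi; omega), zero_mul]
  have e2 : ∑ i ∈ Finset.range ((2 * N + θ) / 2),
      kernelCoef m N sgn (2 * i + 1) * (z : ℂ) ^ (((2 * i + 1 : ℕ) : ℤ) - 2 * N) =
      kernelCoef m N sgn (2 * m - 1) * (z : ℂ) ^ (2 * (m : ℤ) - (2 * N + 1 : ℕ)) := by
    rw [Finset.sum_eq_single (m - 1)]
    · rw [show 2 * (m - 1) + 1 = 2 * m - 1 by omega]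
      congr 2
      omega
    · intro i hi hne
      rw [kernelCoef_eq_zero_of_odd hm sgn (odd_two_mul_add_one i), zero_mul]
      rintro ⟨c, hc⟩
      have := Finset.mem_range.mp hi
      have hc1 : i + 1 = m * c := by linarith
      have hc2 : c < 2 := by
        by_contra hc2
        have := Nat.mul_le_mul_left m (not_lt.mp hc2)
        omega
      interval_cases c <;> omega
    · intro h
      exact absurd (Finset.mem_range.mpr (by omega)) h
  rw [e1, zero_add, e2]
  congr 1
  refine Finset.sum_congr rfl fun j _ => ?_
  rw [← zpow_natCast, mul_add]
  congr 2
  push_cast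
  ring

/-- Expansion of the free resolvent kernel, middle case:
either `1 ≤ n ≤ 2m-1` and `2m-n+1 ≤ θ ≤ 4m-n`, or `2m+1 ≤ n ≤ 4m-1` and `θ = 0`.
Here the constant term `b₀ |x-y|^{2m-n}` appears; `b₀ ≠ 0` depends only on `n, m`. -/
theorem free_resolvent_expansion_middle
    (m n θ : ℕ) (hm : 2 ≤ m) (hodd : Odd n)
    (hcase : (1 ≤ n ∧ n ≤ 2 * m - 1 ∧ 2 * m - n + 1 ≤ θ ∧ θ ≤ 4 * m - n) ∨
             (2 * m + 1 ≤ n ∧ n ≤ 4 * m - 1 ∧ θ = 0)) :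
    ∃ b0 : ℝ, b0 ≠ 0 ∧ ∀ sgn : Bool, ∃ (a : ℕ → ℂ) (r : ℝ → ℂ),
      (∀ j ∈ Finset.range ((θ + 1) / 2), (a j).im ≠ 0) ∧
      (∀ k : ℕ, ContDiffOn ℝ k r (Set.Ioi 0)) ∧
      (∀ lam : ℝ, 0 < lam → ∀ x y : EuclideanSpace ℝ (Fin n), x ≠ y →
        R0Kernel m n sgn lam (dist x y) =
          (∑ j ∈ Finset.range ((θ + 1) / 2),
            a j * (((lam ^ ((n : ℤ) - 2 * (m : ℤ) + 2 * (j : ℤ))) : ℝ) : ℂ) *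
              (((dist x y ^ (2 * j)) : ℝ) : ℂ)) +
          ((b0 : ℝ) : ℂ) * (((dist x y ^ (2 * (m : ℤ) - (n : ℤ))) : ℝ) : ℂ) +
          (((lam ^ ((n : ℤ) - 2 * (m : ℤ))) : ℝ) : ℂ) * r (lam * dist x y)) ∧
      (∀ l : ℕ, ∃ C : ℝ, 0 < C ∧
        (∀ z : ℝ, 0 < z → z ≤ 1 →
          ‖iteratedDerivWithin l r (Set.Ioi 0) z‖ ≤ C * z ^ max ((θ : ℤ) - l) 0) ∧
        (∀ z : ℝ, 1 ≤ z →
          ‖iteratedDerivWithin l r (Set.Ioi 0) z‖ ≤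
            C * z ^ max ((θ : ℤ) - l) (-(((n : ℤ) - 1) / 2)))) := by
  obtain ⟨N, rfl⟩ := hodd
  have hm0 : m ≠ 0 := by omega
  refine ⟨kernelFactor m N * m * -(-1) ^ m * PowerSeries.coeff (2 * m - 1) (profileSeries N),
    ?_, fun sgn => ?_⟩
  · refine mul_ne_zero (mul_ne_zero (mul_ne_zero (kernelFactor_pos hm0 N).ne' ?_) ?_) ?_
    · exact_mod_cast hm0
    · exact neg_ne_zero.mpr (pow_ne_zero _ (by norm_num))
    · exact coeff_profileSeries_ne_zero N _ (Or.inl ⟨m - 1, by omega⟩)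
  rw [← kernelCoef_two_mul_sub_one N hm0 sgn]
  set a : ℕ → ℂ := fun j => kernelCoef m N sgn (2 * N + 2 * j) with ha
  set b : ℂ := kernelCoef m N sgn (2 * m - 1) with hb
  set r : ℝ → ℂ := fun z => unitKernel m N sgn z +
    (∑ j ∈ Finset.range ((θ + 1) / 2), -a j * (z : ℂ) ^ ((2 * j : ℕ) : ℤ) +
      -b * (z : ℂ) ^ (2 * (m : ℤ) - (2 * N + 1 : ℕ))) with hr
  have hgrowth : ∃ f : ℝ → ℂ, Set.EqOn r f (Set.Ioi 0) ∧
      DerivGrowth (fun l => max ((θ : ℤ) - l) (-((((2 * N + 1 : ℕ) : ℤ) - 1) / 2))) f := by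
    refine ⟨_, fun z hz => congrArg (· + _) (unitKernel_eq_sum m N sgn hz),
      (derivGrowth_unitKernel m N sgn fun l => ?_).add
        ((DerivGrowth.sum _ fun j hj => (derivGrowth_zpow fun l => ?_).const_mul _).add
          ((derivGrowth_zpow fun l => ?_).const_mul _))⟩
    · omega
    · have := Finset.mem_range.mp hj
      omega
    · omega
  obtain ⟨f, hrf, hfs, hfb⟩ := hgrowth
  obtain ⟨G, hG, hGz⟩ := unitKernel_expansion m N sgn θ
  have hrG : ∀ z : ℝ, 0 < z → r z = (z : ℂ) ^ θ * G z := by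
    intro z hz
    simp only [hr]
    rw [hGz z hz, sum_kernelCoef hm0 sgn (by omega) (by omega)]
    simp only [zpow_natCast, neg_mul, Finset.sum_neg_distrib, ha, hb]
    ring
  refine ⟨a, r, fun j _ => kernelCoef_im_ne_zero hm0 sgn j, fun k => (hfs k).congr hrf,
    fun lam hl x y hxy => ?_, fun l => ?_⟩
  · have hd : 0 < dist x y := dist_pos.mpr hxy
    generalize dist x y = d at hd
    have hl' : (lam : ℂ) ≠ 0 := by exact_mod_cast hl.ne'
    rw [R0Kernel_eq m N sgn hl hd]
    simp only [hr, zpow_natCast]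
    push_cast
    simp only [neg_mul, Finset.sum_neg_distrib]
    have e1 : ∀ j : ℕ, (lam : ℂ) ^ (2 * (N : ℤ) + 1 - 2 * m + 2 * j) =
        (lam : ℂ) ^ (2 * (N : ℤ) + 1 - 2 * m) * (lam : ℂ) ^ (2 * j) := fun j => by
      rw [zpow_add₀ hl']
      norm_cast
    have e2 : (lam : ℂ) ^ (2 * (N : ℤ) + 1 - 2 * m) * (lam : ℂ) ^ (2 * (m : ℤ) - (2 * N + 1)) =
        1 := by
      rw [← zpow_add₀ hl']
      simp
    have e3 : ∑ j ∈ Finset.range ((θ + 1) / 2),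
        a j * (lam : ℂ) ^ (2 * (N : ℤ) + 1 - 2 * m + 2 * j) * (d : ℂ) ^ (2 * j) =
        (lam : ℂ) ^ (2 * (N : ℤ) + 1 - 2 * m) *
          ∑ j ∈ Finset.range ((θ + 1) / 2), a j * ((lam : ℂ) * d) ^ (2 * j) := by
      rw [Finset.mul_sum]
      exact Finset.sum_congr rfl fun j _ => by rw [e1, mul_pow]; ring
    rw [e3, mul_zpow]
    linear_combination (b * (d : ℂ) ^ (2 * (m : ℤ) - (2 * N + 1))) * e2
  · obtain ⟨A, hA⟩ := exists_iteratedDerivWithin_le_of_eq_pow_mul hG θ l hrG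
    obtain ⟨B, hB⟩ := hfb l
    have hA' : A ≤ |A| + |B| + 1 := by linarith [le_abs_self A, abs_nonneg B]
    have hB' : B ≤ |A| + |B| + 1 := by linarith [le_abs_self B, abs_nonneg A]
    refine ⟨|A| + |B| + 1, by positivity, fun z hz hz1 => ?_, fun z hz => ?_⟩
    · rw [show max ((θ : ℤ) - l) 0 = ((θ - l : ℕ) : ℤ) by omega, zpow_natCast]
      exact (hA z hz hz1).trans (mul_le_mul_of_nonneg_right hA' (by positivity))
    · have hz0 : (0 : ℝ) < z := one_pos.trans_le hz
      rw [iteratedDerivWithin_congr hrf (show z ∈ Set.Ioi (0 : ℝ) from hz0)]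
      exact (hB z hz).trans (mul_le_mul_of_nonneg_right hB' (by positivity))
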